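/- Define the successive approximations u₁⁰(r) = a₁, u₂⁰(r) = a₂ for all r ≥ 0, and for m ≥ 1: u₁^m(r) = a₁ + ∫₀^r (B₁⁻(t)·∫₀^t B₁⁺(s) f₁(u₁^{m−1}(s),u₂^{m−1}(s)) ds)^{1/k₁} dt and u₂^m(r) = a₂ + ∫₀^r (B₂⁻(t)·∫₀^t B₂⁺(s) f₂(u₁^{m−1}(s),u₂^{m−1}(s)) ds)^{1/k₂} dt. Then for every m ≥ 1 and every r ≥ 0 one has F(u₁^m(r) + u₂^m(r)) ≤ P₁(r) + P₂(r); equivalently, u₁^m(r) + u₂^m(r) ≤ F⁻¹(P₁(r) + P₂(r)) whenever P₁(r) + P₂(r) < F(∞). -/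

import Mathlib

open Real Filter MeasureTheory Set

noncomputable section

/-- A pair `(u₁, u₂)` of continuous functions on `[0, ∞)` is a radial solution of the
`(k₁,k₂)`-Hessian system with convection term, with central value `(a₁, a₂)`, in the
radial integral formulation. -/
def IsRadialSolution (k₁ k₂ : ℕ) (a₁ a₂ : ℝ)
    (B₁m B₁p B₂m B₂p : ℝ → ℝ) (f₁ f₂ : ℝ → ℝ → ℝ) (u₁ u₂ : ℝ → ℝ) : Prop :=
  ContinuousOn u₁ (Set.Ici 0) ∧ ContinuousOn u₂ (Set.Ici 0) ∧
  (∀ r ∈ Set.Ici (0:ℝ),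
    u₁ r = a₁ + ∫ y in (0:ℝ)..r,
      (B₁m y * ∫ t in (0:ℝ)..y, B₁p t * f₁ (u₁ t) (u₂ t)) ^ (1/(k₁:ℝ))) ∧
  (∀ r ∈ Set.Ici (0:ℝ),
    u₂ r = a₂ + ∫ y in (0:ℝ)..r,
      (B₂m y * ∫ t in (0:ℝ)..y, B₂p t * f₂ (u₁ t) (u₂ t)) ^ (1/(k₂:ℝ)))

/-- The properties of a pair of radial weights used in the estimates below: nonnegativity,
continuity, and `Bm t * ∫₀ᵗ Bp → 0` as `t → 0⁺`. -/
structure IsRadialWeightPair (Bm Bp : ℝ → ℝ) : Prop where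
  continuousOn_left : ContinuousOn Bm (Set.Ioi 0)
  continuousOn_right : ContinuousOn Bp (Set.Ici 0)
  nonneg_left : ∀ t ∈ Set.Ici (0:ℝ), 0 ≤ Bm t
  nonneg_right : ∀ t ∈ Set.Ici (0:ℝ), 0 ≤ Bp t
  tendsto_zero : Tendsto (fun t => Bm t * ∫ s in (0:ℝ)..t, Bp s) (nhdsWithin 0 (Set.Ioi 0)) (nhds 0)

/-- The integrand of the radial integral operator with source term `g`. -/
def radialIntegrand (α : ℝ) (Bm Bp g : ℝ → ℝ) (t : ℝ) : ℝ :=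
  (Bm t * ∫ s in (0:ℝ)..t, Bp s * g s) ^ α

lemma ContinuousOn.intervalIntegrable_of_Ici {g : ℝ → ℝ} {a b c : ℝ}
    (hg : ContinuousOn g (Set.Ici a)) (hb : a ≤ b) (hc : a ≤ c) :
    IntervalIntegrable g volume b c :=
  (hg.mono fun _ hx => (le_inf hb hc).trans hx.1).intervalIntegrable

/-- On `[a, ∞)`, a primitive only depends on the values on `[a, ∞)`, so that a function continuous
there may be replaced by its continuous extension `t ↦ g (max t a)`. -/
lemma integral_congr_max {g : ℝ → ℝ} {a r : ℝ} (hr : a ≤ r) :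
    ∫ t in a..r, g t = ∫ t in a..r, g (max t a) := by
  refine intervalIntegral.integral_congr fun t ht => ?_
  rw [Set.uIcc_of_le hr] at ht
  simp only [max_eq_left ht.1]

lemma ContinuousOn.continuous_comp_max {g : ℝ → ℝ} {a : ℝ}
    (hg : ContinuousOn g (Set.Ici a)) : Continuous fun t => g (max t a) :=
  hg.comp_continuous (by fun_prop) fun t => le_max_right t a

lemma ContinuousOn.hasDerivAt_integral_max {g : ℝ → ℝ} {a : ℝ}
    (hg : ContinuousOn g (Set.Ici a)) (r : ℝ) :
    HasDerivAt (fun r => ∫ t in a..r, g (max t a)) (g (max r a)) r :=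
  (hg.continuous_comp_max.integral_hasStrictDerivAt a r).hasDerivAt

lemma ContinuousOn.continuousOn_integral_Ici {g : ℝ → ℝ} {a : ℝ}
    (hg : ContinuousOn g (Set.Ici a)) :
    ContinuousOn (fun r => ∫ t in a..r, g t) (Set.Ici a) := by
  refine ContinuousOn.congr (f := fun r => ∫ t in a..r, g (max t a)) (fun r _ => ?_)
    fun r hr => integral_congr_max hr
  exact (hg.hasDerivAt_integral_max r).continuousAt.continuousWithinAt

lemma monotoneOn_integral_Ici {g : ℝ → ℝ} {a : ℝ}
    (hg : ContinuousOn g (Set.Ici a)) (h0 : ∀ t ∈ Set.Ici a, 0 ≤ g t) :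
    MonotoneOn (fun r => ∫ t in a..r, g t) (Set.Ici a) := by
  intro x hx y hy hxy
  rw [← sub_nonneg, intervalIntegral.integral_interval_sub_left
    (hg.intervalIntegrable_of_Ici le_rfl hy) (hg.intervalIntegrable_of_Ici le_rfl hx)]
  exact intervalIntegral.integral_nonneg hxy fun t ht => h0 t (le_trans hx ht.1)

/-- Integrated form of the differential inequality `U' ≤ φ(U) q`. -/
lemma integral_inv_le_of_le_mul {φ U h q : ℝ → ℝ} {a : ℝ}
    (hφ : ContinuousOn φ (Set.Ici a)) (hφ0 : ∀ t ∈ Set.Ici a, 0 < φ t)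
    (hh : ContinuousOn h (Set.Ici 0)) (hh0 : ∀ t ∈ Set.Ici (0:ℝ), 0 ≤ h t)
    (hq : ContinuousOn q (Set.Ici 0))
    (hU : ∀ r ∈ Set.Ici (0:ℝ), U r = a + ∫ t in (0:ℝ)..r, h t)
    (hle : ∀ t ∈ Set.Ici (0:ℝ), h t ≤ φ (U t) * q t) {r : ℝ} (hr : 0 ≤ r) :
    ∫ t in a..U r, 1 / φ t ≤ ∫ t in (0:ℝ)..r, q t := by
  have hφi : ContinuousOn (fun t => 1 / φ t) (Set.Ici a) :=
    continuousOn_const.div hφ fun t ht => (hφ0 t ht).ne'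
  have hUa : ∀ t ∈ Set.Ici (0:ℝ), a ≤ U t := fun t ht => by
    rw [hU t ht]
    exact le_add_of_nonneg_right (intervalIntegral.integral_nonneg ht fun s hs => hh0 s hs.1)
  have hV : ∀ t, HasDerivAt (fun r => a + ∫ t in (0:ℝ)..r, h (max t 0)) (h (max t 0)) t :=
    fun t => (hh.hasDerivAt_integral_max t).const_add a
  have hUV : ∀ t ∈ Set.Ici (0:ℝ), U t = a + ∫ s in (0:ℝ)..t, h (max s 0) := fun t ht => by
    rw [hU t ht, integral_congr_max ht]
  have hD : ∀ t, HasDerivAt (fun r => (∫ t in (0:ℝ)..r, q (max t 0)) -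
      ∫ t in a..(a + ∫ t in (0:ℝ)..r, h (max t 0)), 1 / φ (max t a)) (q (max t 0) -
      1 / φ (max (a + ∫ t in (0:ℝ)..t, h (max t 0)) a) * h (max t 0)) t := fun t =>
    (hq.hasDerivAt_integral_max t).sub
      ((hφi.hasDerivAt_integral_max _).comp t (hV t))
  have hmono := monotoneOn_of_hasDerivWithinAt_nonneg (convex_Ici (0:ℝ))
    (fun t _ => (hD t).continuousAt.continuousWithinAt)
    (fun t _ => (hD t).hasDerivWithinAt) (fun t ht => by
      have ht : (0:ℝ) ≤ t := interior_subset ht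
      rw [← hUV t ht, max_eq_left ht, max_eq_left (hUa t ht), sub_nonneg, one_div,
        inv_mul_le_iff₀ (hφ0 _ (hUa t ht))]
      exact hle t ht)
  have := hmono (Set.mem_Ici.2 le_rfl) hr hr
  simp only [intervalIntegral.integral_same, add_zero, sub_zero, sub_nonneg] at this
  rw [← hUV r hr] at this
  rwa [integral_congr_max hr, integral_congr_max (hUa r hr)]

lemma le_of_integral_le_of_lt {ψ G : ℝ → ℝ} {a u y s : ℝ}
    (hψ : ContinuousOn ψ (Set.Ici a)) (hψ0 : ∀ t ∈ Set.Ici a, 0 < ψ t)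
    (hG : ∀ x ∈ Set.Ici a, G (∫ t in a..x, ψ t) = x) (hu : a ≤ u)
    (huy : ∫ t in a..u, ψ t ≤ y) (hs : a ≤ s) (hys : y < ∫ t in a..s, ψ t) : u ≤ G y := by
  have h0 : ∫ t in a..a, ψ t ≤ y := by
    refine le_trans ?_ huy
    exact monotoneOn_integral_Ici hψ (fun t ht => (hψ0 t ht).le) (Set.mem_Ici.2 le_rfl) hu hu
  obtain ⟨x, hx, rfl⟩ := intermediate_value_Icc hs
    (hψ.continuousOn_integral_Ici.mono Set.Icc_subset_Ici_self) ⟨h0, hys.le⟩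
  rw [hG x hx.1]
  by_contra! hlt
  refine hlt.ne ?_
  have heq := le_antisymm huy (monotoneOn_integral_Ici hψ (fun t ht => (hψ0 t ht).le) hx.1 hu hlt.le)
  rw [← hG x hx.1, ← hG u hu, heq]

namespace IsRadialWeightPair

variable {α : ℝ} {Bm Bp g g' : ℝ → ℝ}

lemma intervalIntegrable (hB : IsRadialWeightPair Bm Bp) (hg : ContinuousOn g (Set.Ici 0))
    {t : ℝ} (ht : 0 ≤ t) : IntervalIntegrable (fun s => Bp s * g s) volume 0 t :=
  (hB.continuousOn_right.mul hg).intervalIntegrable_of_Ici le_rfl ht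

lemma base_nonneg (hB : IsRadialWeightPair Bm Bp) (hg0 : ∀ s ∈ Set.Ici (0:ℝ), 0 ≤ g s)
    {t : ℝ} (ht : 0 ≤ t) : 0 ≤ Bm t * ∫ s in (0:ℝ)..t, Bp s * g s :=
  mul_nonneg (hB.nonneg_left t ht) (intervalIntegral.integral_nonneg ht fun s hs =>
    mul_nonneg (hB.nonneg_right s hs.1) (hg0 s hs.1))

lemma base_mono (hB : IsRadialWeightPair Bm Bp) (hg : ContinuousOn g (Set.Ici 0))
    (hg' : ContinuousOn g' (Set.Ici 0)) {t : ℝ} (ht : 0 ≤ t)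
    (hle : ∀ s ∈ Set.Icc 0 t, g s ≤ g' s) :
    Bm t * ∫ s in (0:ℝ)..t, Bp s * g s ≤ Bm t * ∫ s in (0:ℝ)..t, Bp s * g' s :=
  mul_le_mul_of_nonneg_left (intervalIntegral.integral_mono_on ht (hB.intervalIntegrable hg ht)
    (hB.intervalIntegrable hg' ht) fun s hs =>
      mul_le_mul_of_nonneg_left (hle s hs) (hB.nonneg_right s hs.1)) (hB.nonneg_left t ht)

lemma base_le_const (hB : IsRadialWeightPair Bm Bp) (hg : ContinuousOn g (Set.Ici 0))
    {c t : ℝ} (ht : 0 ≤ t) (hle : ∀ s ∈ Set.Icc 0 t, g s ≤ c) :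
    Bm t * ∫ s in (0:ℝ)..t, Bp s * g s ≤ c * (Bm t * ∫ s in (0:ℝ)..t, Bp s) := by
  refine (hB.base_mono hg continuousOn_const ht hle).trans_eq ?_
  rw [intervalIntegral.integral_mul_const]
  ring

lemma integrand_nonneg (hB : IsRadialWeightPair Bm Bp) (hg0 : ∀ s ∈ Set.Ici (0:ℝ), 0 ≤ g s)
    {t : ℝ} (ht : 0 ≤ t) : 0 ≤ radialIntegrand α Bm Bp g t :=
  Real.rpow_nonneg (hB.base_nonneg hg0 ht) α

lemma integrand_mono (hB : IsRadialWeightPair Bm Bp) (hα : 0 ≤ α)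
    (hg : ContinuousOn g (Set.Ici 0)) (hg0 : ∀ s ∈ Set.Ici (0:ℝ), 0 ≤ g s)
    (hg' : ContinuousOn g' (Set.Ici 0)) {t : ℝ} (ht : 0 ≤ t)
    (hle : ∀ s ∈ Set.Icc 0 t, g s ≤ g' s) :
    radialIntegrand α Bm Bp g t ≤ radialIntegrand α Bm Bp g' t :=
  Real.rpow_le_rpow (hB.base_nonneg hg0 ht) (hB.base_mono hg hg' ht hle) hα

lemma integrand_le_const (hB : IsRadialWeightPair Bm Bp) (hα : 0 ≤ α)
    (hg : ContinuousOn g (Set.Ici 0)) (hg0 : ∀ s ∈ Set.Ici (0:ℝ), 0 ≤ g s)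
    {c t : ℝ} (hc : 0 ≤ c) (ht : 0 ≤ t) (hle : ∀ s ∈ Set.Icc 0 t, g s ≤ c) :
    radialIntegrand α Bm Bp g t ≤ c ^ α * radialIntegrand α Bm Bp (fun _ => 1) t := by
  have h1 := hB.base_nonneg (g := fun _ => 1) (fun _ _ => zero_le_one) ht
  simp only [mul_one] at h1
  simp only [radialIntegrand, mul_one]
  rw [← Real.mul_rpow hc h1]
  exact Real.rpow_le_rpow (hB.base_nonneg hg0 ht) (hB.base_le_const hg ht hle) hα

lemma continuousOn_integrand (hB : IsRadialWeightPair Bm Bp) (hα : 0 < α)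
    (hg : ContinuousOn g (Set.Ici 0)) (hg0 : ∀ s ∈ Set.Ici (0:ℝ), 0 ≤ g s) :
    ContinuousOn (radialIntegrand α Bm Bp g) (Set.Ici 0) := by
  have hI := (hB.continuousOn_right.mul hg).continuousOn_integral_Ici
  refine ContinuousOn.rpow_const (fun t ht => ?_) fun _ _ => Or.inr hα.le
  rcases eq_or_lt_of_le (Set.mem_Ici.1 ht) with rfl | ht
  · rw [← continuousWithinAt_Ioi_iff_Ici]
    obtain ⟨c, hc⟩ := isCompact_Icc.bddAbove_image
      (hg.mono (Set.Icc_subset_Ici_self (a := 1) (b := (0:ℝ))))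
    simp only [ContinuousWithinAt, intervalIntegral.integral_same, mul_zero]
    refine squeeze_zero' (g := fun t => c * (Bm t * ∫ s in (0:ℝ)..t, Bp s)) ?_ ?_ ?_
    · filter_upwards [self_mem_nhdsWithin] with t ht using hB.base_nonneg hg0 (le_of_lt ht)
    · filter_upwards [Ioc_mem_nhdsGT (zero_lt_one (α := ℝ))] with t ht
      exact hB.base_le_const hg ht.1.le fun s hs =>
        hc (Set.mem_image_of_mem g ⟨hs.1, hs.2.trans ht.2⟩)
    · simpa using hB.tendsto_zero.const_mul c
  · exact ((hB.continuousOn_left.continuousAt (Ioi_mem_nhds ht)).mul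
      (hI.continuousAt (Ici_mem_nhds ht))).continuousWithinAt

end IsRadialWeightPair

lemma isRadialWeightPair_hessian {N k : ℕ} (hk : 1 ≤ k) (hN : 1 ≤ N) {C : ℝ} (hC : 0 < C)
    {b p Bm Bp : ℝ → ℝ}
    (hb : ContinuousOn b (Set.Ici 0)) (hb0 : ∀ t ∈ Set.Ici (0:ℝ), 0 ≤ b t)
    (hp : ContinuousOn p (Set.Ici 0)) (hp0 : ∀ t ∈ Set.Ici (0:ℝ), 0 ≤ p t)
    (hBm : ∀ ξ : ℝ, Bm ξ = ξ ^ ((k : ℤ) - (N : ℤ)) / C *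
      Real.exp (-(∫ t in (0:ℝ)..ξ, (1 / C) * t ^ (k - 1) * b t)))
    (hBp : ∀ ξ : ℝ, Bp ξ = ξ ^ (N - 1) *
      Real.exp (∫ t in (0:ℝ)..ξ, (1 / C) * t ^ (k - 1) * b t) * p ξ) :
    IsRadialWeightPair Bm Bp := by
  have hE : ContinuousOn (fun ξ => ∫ t in (0:ℝ)..ξ, (1 / C) * t ^ (k - 1) * b t) (Set.Ici 0) :=
    ContinuousOn.continuousOn_integral_Ici (by fun_prop)
  have hE0 : ∀ ξ ∈ Set.Ici (0:ℝ), 0 ≤ ∫ t in (0:ℝ)..ξ, (1 / C) * t ^ (k - 1) * b t :=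
    fun ξ hξ => intervalIntegral.integral_nonneg hξ fun t ht => by
      have := hb0 t ht.1
      have := ht.1
      positivity
  obtain rfl : Bm = _ := funext hBm
  obtain rfl : Bp = _ := funext hBp
  clear hBm hBp
  set E : ℝ → ℝ := fun ξ => ∫ t in (0:ℝ)..ξ, (1 / C) * t ^ (k - 1) * b t with hEdef
  have hEp : ContinuousOn (fun ξ => Real.exp (E ξ) * p ξ) (Set.Ici 0) := hE.rexp.mul hp
  have hright : ContinuousOn (fun ξ => ξ ^ (N - 1) * Real.exp (E ξ) * p ξ) (Set.Ici 0) :=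
    ((by fun_prop : ContinuousOn (fun ξ : ℝ => ξ ^ (N - 1)) (Set.Ici 0)).mul hE.rexp).mul hp
  have hleft0 : ∀ t ∈ Set.Ici (0:ℝ), 0 ≤ t ^ ((k : ℤ) - (N : ℤ)) / C * Real.exp (-E t) :=
    fun t ht => mul_nonneg (div_nonneg (zpow_nonneg ht _) hC.le) (Real.exp_pos _).le
  have hright0 : ∀ t ∈ Set.Ici (0:ℝ), 0 ≤ t ^ (N - 1) * Real.exp (E t) * p t :=
    fun t ht => mul_nonneg (mul_nonneg (pow_nonneg ht _) (Real.exp_pos _).le) (hp0 t ht)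
  refine ⟨?_, hright, hleft0, hright0, ?_⟩
  · refine ContinuousOn.mul (ContinuousOn.div_const (fun t ht => ?_) C)
      (hE.mono Set.Ioi_subset_Ici_self).neg.rexp
    exact (continuousAt_zpow₀ t _ (Or.inl (ne_of_gt ht))).continuousWithinAt
  · obtain ⟨M, hM⟩ := isCompact_Icc.bddAbove_image
      (hEp.mono (Set.Icc_subset_Ici_self (a := 1) (b := (0:ℝ))))
    refine squeeze_zero' (g := fun t => M / C * t ^ k) ?_ ?_ ?_
    · filter_upwards [self_mem_nhdsWithin] with t ht
      have ht' := Set.Ioi_subset_Ici_self ht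
      exact mul_nonneg (hleft0 t ht') (intervalIntegral.integral_nonneg ht'
        fun s hs => hright0 s hs.1)
    · filter_upwards [Ioc_mem_nhdsGT (zero_lt_one (α := ℝ))] with t ht
      have hint : ∫ s in (0:ℝ)..t, s ^ (N - 1) * Real.exp (E s) * p s ≤ t ^ N * M := by
        refine (intervalIntegral.integral_mono_on (g := fun _ => t ^ (N - 1) * M) ht.1.le
          (hright.intervalIntegrable_of_Ici le_rfl ht.1.le) intervalIntegrable_const
          fun s hs => ?_).trans_eq ?_
        · rw [mul_assoc]
          exact mul_le_mul (pow_le_pow_left₀ hs.1 hs.2 _)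
            (hM (Set.mem_image_of_mem _ ⟨hs.1, hs.2.trans ht.2⟩))
            (mul_nonneg (Real.exp_pos _).le (hp0 s hs.1)) (pow_nonneg ht.1.le _)
        · rw [intervalIntegral.integral_const, smul_eq_mul, sub_zero, ← mul_assoc,
            mul_pow_sub_one (by lia)]
      have hexp : Real.exp (-E t) ≤ 1 := Real.exp_le_one_iff.2 (neg_nonpos.2 (hE0 t ht.1.le))
      have hz : (0:ℝ) ≤ t ^ ((k : ℤ) - (N : ℤ)) / C := div_nonneg (zpow_nonneg ht.1.le _) hC.le
      have h0 : 0 ≤ ∫ s in (0:ℝ)..t, s ^ (N - 1) * Real.exp (E s) * p s :=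
        intervalIntegral.integral_nonneg ht.1.le fun s hs => hright0 s hs.1
      calc t ^ ((k : ℤ) - (N : ℤ)) / C * Real.exp (-E t) *
            ∫ s in (0:ℝ)..t, s ^ (N - 1) * Real.exp (E s) * p s
          ≤ t ^ ((k : ℤ) - (N : ℤ)) / C * (t ^ N * M) :=
            mul_le_mul (mul_le_of_le_one_right hz hexp) hint h0 hz
        _ = M / C * t ^ k := by
            rw [zpow_sub₀ ht.1.ne', zpow_natCast, zpow_natCast]
            have := (pow_pos ht.1 N).ne'
            field_simp
    · have h : Tendsto (fun t : ℝ => M / C * t ^ k) (nhds 0) (nhds (M / C * 0 ^ k)) :=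
        Continuous.tendsto (by fun_prop) 0
      rw [zero_pow (by lia), mul_zero] at h
      exact h.mono_left nhdsWithin_le_nhds

/-- The regularity shared by all successive approximations with central value `a`. -/
structure IsRadialProfile (a : ℝ) (u : ℝ → ℝ) : Prop where
  continuousOn : ContinuousOn u (Set.Ici 0)
  monotoneOn : MonotoneOn u (Set.Ici 0)
  le : ∀ t ∈ Set.Ici (0:ℝ), a ≤ u t

lemma isRadialProfile_const (a : ℝ) : IsRadialProfile a fun _ => a :=
  ⟨continuousOn_const, monotoneOn_const, fun _ _ => le_rfl⟩

lemma IsRadialWeightPair.isRadialProfile {α a : ℝ} {Bm Bp g u : ℝ → ℝ}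
    (hB : IsRadialWeightPair Bm Bp) (hα : 0 < α)
    (hg : ContinuousOn g (Set.Ici 0)) (hg0 : ∀ s ∈ Set.Ici (0:ℝ), 0 ≤ g s)
    (hu : ∀ r, u r = a + ∫ t in (0:ℝ)..r, radialIntegrand α Bm Bp g t) :
    IsRadialProfile a u := by
  obtain rfl : u = _ := funext hu
  have hc := hB.continuousOn_integrand hα hg hg0
  have h0 : ∀ t ∈ Set.Ici (0:ℝ), 0 ≤ radialIntegrand α Bm Bp g t :=
    fun t ht => hB.integrand_nonneg hg0 ht
  exact ⟨continuousOn_const.add hc.continuousOn_integral_Ici,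
    (monotoneOn_integral_Ici hc h0).const_add a,
    fun t ht => le_add_of_nonneg_right
      (intervalIntegral.integral_nonneg ht fun s hs => h0 s hs.1)⟩

/-- A source term evaluated along two nonnegative radial profiles. -/
lemma continuousOn_source {f : ℝ → ℝ → ℝ} {a₁ a₂ : ℝ} {u₁ u₂ : ℝ → ℝ}
    (hf : ContinuousOn (fun q : ℝ × ℝ => f q.1 q.2) (Set.Ici 0 ×ˢ Set.Ici 0))
    (ha₁ : 0 ≤ a₁) (ha₂ : 0 ≤ a₂) (h₁ : IsRadialProfile a₁ u₁) (h₂ : IsRadialProfile a₂ u₂) :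
    ContinuousOn (fun s => f (u₁ s) (u₂ s)) (Set.Ici 0) :=
  hf.comp (f := fun s => (u₁ s, u₂ s)) (h₁.continuousOn.prodMk h₂.continuousOn)
    fun s hs => ⟨ha₁.trans (h₁.le s hs), ha₂.trans (h₂.le s hs)⟩

/-- The integrand at stage `m + 1` is controlled by the diagonal values of the source term at
stage `m + 1`. -/
lemma IsRadialWeightPair.integrand_source_le {f : ℝ → ℝ → ℝ} {α a₁ a₂ t : ℝ}
    {Bm Bp u₁ u₂ w₁ w₂ : ℝ → ℝ}
    (hB : IsRadialWeightPair Bm Bp) (hα : 0 ≤ α)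
    (hf : ContinuousOn (fun q : ℝ × ℝ => f q.1 q.2) (Set.Ici 0 ×ˢ Set.Ici 0))
    (hf0 : ∀ x ∈ Set.Ici (0:ℝ), ∀ y ∈ Set.Ici (0:ℝ), 0 ≤ f x y)
    (hfmono : ∀ x xQ y yQ : ℝ, 0 ≤ x → x ≤ xQ → 0 ≤ y → y ≤ yQ → f x y ≤ f xQ yQ)
    (ha₁ : 0 ≤ a₁) (ha₂ : 0 ≤ a₂) (hu₁ : IsRadialProfile a₁ u₁) (hu₂ : IsRadialProfile a₂ u₂)
    (hw₁ : ∀ s ∈ Set.Ici (0:ℝ), u₁ s ≤ w₁ s) (hw₂ : ∀ s ∈ Set.Ici (0:ℝ), u₂ s ≤ w₂ s)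
    (ht : 0 ≤ t) :
    radialIntegrand α Bm Bp (fun s => f (u₁ s) (u₂ s)) t ≤
      f (w₁ t + w₂ t) (w₁ t + w₂ t) ^ α * radialIntegrand α Bm Bp (fun _ => 1) t := by
  have h0₁ : ∀ s ∈ Set.Ici (0:ℝ), 0 ≤ u₁ s := fun s hs => ha₁.trans (hu₁.le s hs)
  have h0₂ : ∀ s ∈ Set.Ici (0:ℝ), 0 ≤ u₂ s := fun s hs => ha₂.trans (hu₂.le s hs)
  have hw0₁ := (h0₁ t ht).trans (hw₁ t ht)
  have hw0₂ := (h0₂ t ht).trans (hw₂ t ht)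
  refine hB.integrand_le_const hα (continuousOn_source hf ha₁ ha₂ hu₁ hu₂)
    (fun s hs => hf0 _ (h0₁ s hs) _ (h0₂ s hs))
    (hf0 _ (add_nonneg hw0₁ hw0₂) _ (add_nonneg hw0₁ hw0₂)) ht fun s hs => ?_
  have h₁ := (hu₁.monotoneOn hs.1 ht hs.2).trans (hw₁ t ht)
  have h₂ := (hu₂.monotoneOn hs.1 ht hs.2).trans (hw₂ t ht)
  exact hfmono _ _ _ _ (h0₁ s hs.1) (by linarith) (h0₂ s hs.1) (by linarith)

lemma IsRadialWeightPair.approximation_mono {f : ℝ → ℝ → ℝ} {α a a₁ a₂ : ℝ}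
    {Bm Bp u₁ u₂ w₁ w₂ u w : ℝ → ℝ}
    (hB : IsRadialWeightPair Bm Bp) (hα : 0 < α)
    (hf : ContinuousOn (fun q : ℝ × ℝ => f q.1 q.2) (Set.Ici 0 ×ˢ Set.Ici 0))
    (hf0 : ∀ x ∈ Set.Ici (0:ℝ), ∀ y ∈ Set.Ici (0:ℝ), 0 ≤ f x y)
    (hfmono : ∀ x xQ y yQ : ℝ, 0 ≤ x → x ≤ xQ → 0 ≤ y → y ≤ yQ → f x y ≤ f xQ yQ)
    (ha₁ : 0 ≤ a₁) (ha₂ : 0 ≤ a₂) (hu₁ : IsRadialProfile a₁ u₁) (hu₂ : IsRadialProfile a₂ u₂)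
    (hw₁ : IsRadialProfile a₁ w₁) (hw₂ : IsRadialProfile a₂ w₂)
    (h₁ : ∀ s ∈ Set.Ici (0:ℝ), u₁ s ≤ w₁ s) (h₂ : ∀ s ∈ Set.Ici (0:ℝ), u₂ s ≤ w₂ s)
    (hu : ∀ r, u r = a + ∫ t in (0:ℝ)..r, radialIntegrand α Bm Bp (fun s => f (u₁ s) (u₂ s)) t)
    (hw : ∀ r, w r = a + ∫ t in (0:ℝ)..r, radialIntegrand α Bm Bp (fun s => f (w₁ s) (w₂ s)) t) :
    ∀ r ∈ Set.Ici (0:ℝ), u r ≤ w r := by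
  intro r hr
  have h0₁ : ∀ s ∈ Set.Ici (0:ℝ), 0 ≤ u₁ s := fun s hs => ha₁.trans (hu₁.le s hs)
  have h0₂ : ∀ s ∈ Set.Ici (0:ℝ), 0 ≤ u₂ s := fun s hs => ha₂.trans (hu₂.le s hs)
  have hsu := continuousOn_source hf ha₁ ha₂ hu₁ hu₂
  have hsw := continuousOn_source hf ha₁ ha₂ hw₁ hw₂
  have hsu0 : ∀ s ∈ Set.Ici (0:ℝ), 0 ≤ f (u₁ s) (u₂ s) :=
    fun s hs => hf0 _ (h0₁ s hs) _ (h0₂ s hs)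
  have hle : ∀ s ∈ Set.Ici (0:ℝ), f (u₁ s) (u₂ s) ≤ f (w₁ s) (w₂ s) :=
    fun s hs => hfmono _ _ _ _ (h0₁ s hs) (h₁ s hs) (h0₂ s hs) (h₂ s hs)
  rw [hu, hw]
  refine add_le_add_right (intervalIntegral.integral_mono_on hr
    ((hB.continuousOn_integrand hα hsu hsu0).intervalIntegrable_of_Ici le_rfl hr)
    ((hB.continuousOn_integrand hα hsw fun s hs =>
      (hsu0 s hs).trans (hle s hs)).intervalIntegrable_of_Ici le_rfl hr) fun t ht => ?_) a
  exact hB.integrand_mono hα.le hsu hsu0 hsw ht.1 fun s hs => hle s hs.1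

/-- Key estimate for the successive approximations: for every `m ≥ 1` and `r ≥ 0`,
`F(u₁^m(r) + u₂^m(r)) ≤ P₁(r) + P₂(r)`; equivalently, whenever
`P₁(r) + P₂(r) < F(∞)` (i.e. `P₁(r) + P₂(r)` is dominated by some value of `F`),
`u₁^m(r) + u₂^m(r) ≤ F⁻¹(P₁(r) + P₂(r))`. -/
theorem hessian_successive_approximations_key_estimate
    (N k₁ k₂ : ℕ) (hN : 3 ≤ N) (hk₁ : 1 ≤ k₁) (hk₁N : k₁ ≤ N) (hk₂ : 1 ≤ k₂) (hk₂N : k₂ ≤ N)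
    (b₁ b₂ p₁ p₂ : ℝ → ℝ)
    (hb₁c : ContinuousOn b₁ (Set.Ici 0)) (hb₂c : ContinuousOn b₂ (Set.Ici 0))
    (hp₁c : ContinuousOn p₁ (Set.Ici 0)) (hp₂c : ContinuousOn p₂ (Set.Ici 0))
    (hb₁0 : ∀ t ∈ Set.Ici (0:ℝ), 0 ≤ b₁ t) (hb₂0 : ∀ t ∈ Set.Ici (0:ℝ), 0 ≤ b₂ t)
    (hp₁0 : ∀ t ∈ Set.Ici (0:ℝ), 0 ≤ p₁ t) (hp₂0 : ∀ t ∈ Set.Ici (0:ℝ), 0 ≤ p₂ t)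
    (C₀ C₀₀ : ℝ)
    (hC₀ : C₀ = (Nat.factorial (N-1) : ℝ) / ((Nat.factorial k₁ : ℝ) * (Nat.factorial (N - k₁) : ℝ)))
    (hC₀₀ : C₀₀ = (Nat.factorial (N-1) : ℝ) / ((Nat.factorial k₂ : ℝ) * (Nat.factorial (N - k₂) : ℝ)))
    (B₁m B₁p B₂m B₂p : ℝ → ℝ)
    (hB₁m : ∀ ξ : ℝ, B₁m ξ = ξ ^ ((k₁ : ℤ) - (N : ℤ)) / C₀ *
      Real.exp (-(∫ t in (0:ℝ)..ξ, (1 / C₀) * t ^ (k₁ - 1) * b₁ t)))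
    (hB₁p : ∀ ξ : ℝ, B₁p ξ = ξ ^ (N - 1) *
      Real.exp (∫ t in (0:ℝ)..ξ, (1 / C₀) * t ^ (k₁ - 1) * b₁ t) * p₁ ξ)
    (hB₂m : ∀ ξ : ℝ, B₂m ξ = ξ ^ ((k₂ : ℤ) - (N : ℤ)) / C₀₀ *
      Real.exp (-(∫ t in (0:ℝ)..ξ, (1 / C₀₀) * t ^ (k₂ - 1) * b₂ t)))
    (hB₂p : ∀ ξ : ℝ, B₂p ξ = ξ ^ (N - 1) *
      Real.exp (∫ t in (0:ℝ)..ξ, (1 / C₀₀) * t ^ (k₂ - 1) * b₂ t) * p₂ ξ)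
    (a₁ a₂ : ℝ) (ha₁ : 0 ≤ a₁) (ha₂ : 0 ≤ a₂) (ha : 0 < a₁ + a₂)
    (f₁ f₂ : ℝ → ℝ → ℝ)
    (hf₁c : ContinuousOn (fun q : ℝ × ℝ => f₁ q.1 q.2) (Set.Ici 0 ×ˢ Set.Ici 0))
    (hf₂c : ContinuousOn (fun q : ℝ × ℝ => f₂ q.1 q.2) (Set.Ici 0 ×ˢ Set.Ici 0))
    (hf₁0 : ∀ x ∈ Set.Ici (0:ℝ), ∀ y ∈ Set.Ici (0:ℝ), 0 ≤ f₁ x y)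
    (hf₂0 : ∀ x ∈ Set.Ici (0:ℝ), ∀ y ∈ Set.Ici (0:ℝ), 0 ≤ f₂ x y)
    (hf₁mono : ∀ x xQ y yQ : ℝ, 0 ≤ x → x ≤ xQ → 0 ≤ y → y ≤ yQ → f₁ x y ≤ f₁ xQ yQ)
    (hf₂mono : ∀ x xQ y yQ : ℝ, 0 ≤ x → x ≤ xQ → 0 ≤ y → y ≤ yQ → f₂ x y ≤ f₂ xQ yQ)
    (P₁ P₂ : ℝ → ℝ)
    (hP₁ : ∀ r : ℝ, P₁ r = ∫ t in (0:ℝ)..r, (B₁m t * ∫ s in (0:ℝ)..t, B₁p s) ^ (1/(k₁:ℝ)))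
    (hP₂ : ∀ r : ℝ, P₂ r = ∫ t in (0:ℝ)..r, (B₂m t * ∫ s in (0:ℝ)..t, B₂p s) ^ (1/(k₂:ℝ)))
    (F : ℝ → ℝ)
    (hF : ∀ r : ℝ, F r = ∫ t in (a₁+a₂)..r, 1 / (f₁ t t ^ (1/(k₁:ℝ)) + f₂ t t ^ (1/(k₂:ℝ))))
    (hfpos : ∀ t : ℝ, a₁ + a₂ ≤ t → 0 < f₁ t t ^ (1/(k₁:ℝ)) + f₂ t t ^ (1/(k₂:ℝ)))
    (Finv : ℝ → ℝ) (hFinv : ∀ s : ℝ, a₁ + a₂ ≤ s → Finv (F s) = s)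
    (v₁ v₂ : ℕ → ℝ → ℝ)
    (hv₁0 : ∀ r : ℝ, v₁ 0 r = a₁) (hv₂0 : ∀ r : ℝ, v₂ 0 r = a₂)
    (hv₁s : ∀ m : ℕ, ∀ r : ℝ, v₁ (m+1) r = a₁ + ∫ t in (0:ℝ)..r,
      (B₁m t * ∫ s in (0:ℝ)..t, B₁p s * f₁ (v₁ m s) (v₂ m s)) ^ (1/(k₁:ℝ)))
    (hv₂s : ∀ m : ℕ, ∀ r : ℝ, v₂ (m+1) r = a₂ + ∫ t in (0:ℝ)..r,
      (B₂m t * ∫ s in (0:ℝ)..t, B₂p s * f₂ (v₁ m s) (v₂ m s)) ^ (1/(k₂:ℝ))) :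
    ∀ m : ℕ, 1 ≤ m → ∀ r ∈ Set.Ici (0:ℝ),
      F (v₁ m r + v₂ m r) ≤ P₁ r + P₂ r ∧
      ((∃ s : ℝ, a₁ + a₂ ≤ s ∧ P₁ r + P₂ r < F s) →
        v₁ m r + v₂ m r ≤ Finv (P₁ r + P₂ r)) := by
  have hα₁ : (0:ℝ) < 1 / (k₁:ℝ) := by positivity
  have hα₂ : (0:ℝ) < 1 / (k₂:ℝ) := by positivity
  have hB₁ := isRadialWeightPair_hessian hk₁ (by lia) (hC₀ ▸ by positivity)
    hb₁c hb₁0 hp₁c hp₁0 hB₁m hB₁p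
  have hB₂ := isRadialWeightPair_hessian hk₂ (by lia) (hC₀₀ ▸ by positivity)
    hb₂c hb₂0 hp₂c hp₂0 hB₂m hB₂p
  have hprof : ∀ m, IsRadialProfile a₁ (v₁ m) ∧ IsRadialProfile a₂ (v₂ m) := by
    intro m
    induction m with
    | zero =>
      rw [funext hv₁0, funext hv₂0]
      exact ⟨isRadialProfile_const a₁, isRadialProfile_const a₂⟩
    | succ m ih =>
      have h0₁ : ∀ s ∈ Set.Ici (0:ℝ), 0 ≤ v₁ m s := fun s hs => ha₁.trans (ih.1.le s hs)
      have h0₂ : ∀ s ∈ Set.Ici (0:ℝ), 0 ≤ v₂ m s := fun s hs => ha₂.trans (ih.2.le s hs)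
      exact ⟨hB₁.isRadialProfile hα₁ (continuousOn_source hf₁c ha₁ ha₂ ih.1 ih.2)
          (fun s hs => hf₁0 _ (h0₁ s hs) _ (h0₂ s hs)) (hv₁s m),
        hB₂.isRadialProfile hα₂ (continuousOn_source hf₂c ha₁ ha₂ ih.1 ih.2)
          (fun s hs => hf₂0 _ (h0₁ s hs) _ (h0₂ s hs)) (hv₂s m)⟩
  have hmono : ∀ m, (∀ s ∈ Set.Ici (0:ℝ), v₁ m s ≤ v₁ (m + 1) s) ∧
      ∀ s ∈ Set.Ici (0:ℝ), v₂ m s ≤ v₂ (m + 1) s := by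
    intro m
    induction m with
    | zero =>
      simp only [hv₁0, hv₂0]
      exact ⟨(hprof 1).1.le, (hprof 1).2.le⟩
    | succ m ih =>
      exact ⟨hB₁.approximation_mono hα₁ hf₁c hf₁0 hf₁mono ha₁ ha₂ (hprof m).1 (hprof m).2
          (hprof (m + 1)).1 (hprof (m + 1)).2 ih.1 ih.2 (hv₁s m) (hv₁s (m + 1)),
        hB₂.approximation_mono hα₂ hf₂c hf₂0 hf₂mono ha₁ ha₂ (hprof m).1 (hprof m).2
          (hprof (m + 1)).1 (hprof (m + 1)).2 ih.1 ih.2 (hv₂s m) (hv₂s (m + 1))⟩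
  have hdiag : ∀ t ∈ Set.Ici (a₁ + a₂), (t, t) ∈ Set.Ici (0:ℝ) ×ˢ Set.Ici (0:ℝ) :=
    fun t ht => ⟨ha.le.trans ht, ha.le.trans ht⟩
  have hφ : ContinuousOn (fun t => f₁ t t ^ (1/(k₁:ℝ)) + f₂ t t ^ (1/(k₂:ℝ)))
      (Set.Ici (a₁ + a₂)) := by
    refine ContinuousOn.add (ContinuousOn.rpow_const ?_ fun _ _ => Or.inr hα₁.le)
      (ContinuousOn.rpow_const ?_ fun _ _ => Or.inr hα₂.le)
    · exact hf₁c.comp (f := fun t : ℝ => (t, t)) (by fun_prop) hdiag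
    · exact hf₂c.comp (f := fun t : ℝ => (t, t)) (by fun_prop) hdiag
  intro m hm r hr
  obtain ⟨m, rfl⟩ := Nat.exists_eq_add_of_le' hm
  obtain ⟨hu₁, hu₂⟩ := hprof m
  obtain ⟨hw₁, hw₂⟩ := hprof (m + 1)
  obtain ⟨hle₁, hle₂⟩ := hmono m
  have h0₁ : ∀ s ∈ Set.Ici (0:ℝ), 0 ≤ v₁ m s := fun s hs => ha₁.trans (hu₁.le s hs)
  have h0₂ : ∀ s ∈ Set.Ici (0:ℝ), 0 ≤ v₂ m s := fun s hs => ha₂.trans (hu₂.le s hs)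
  have hs0₁ : ∀ s ∈ Set.Ici (0:ℝ), 0 ≤ f₁ (v₁ m s) (v₂ m s) :=
    fun s hs => hf₁0 _ (h0₁ s hs) _ (h0₂ s hs)
  have hs0₂ : ∀ s ∈ Set.Ici (0:ℝ), 0 ≤ f₂ (v₁ m s) (v₂ m s) :=
    fun s hs => hf₂0 _ (h0₁ s hs) _ (h0₂ s hs)
  have hh₁ := hB₁.continuousOn_integrand hα₁ (continuousOn_source hf₁c ha₁ ha₂ hu₁ hu₂) hs0₁
  have hh₂ := hB₂.continuousOn_integrand hα₂ (continuousOn_source hf₂c ha₁ ha₂ hu₁ hu₂) hs0₂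
  have hq₁ := hB₁.continuousOn_integrand (g := fun _ => 1) hα₁ continuousOn_const
    fun _ _ => zero_le_one
  have hq₂ := hB₂.continuousOn_integrand (g := fun _ => 1) hα₂ continuousOn_const
    fun _ _ => zero_le_one
  have hP : P₁ r + P₂ r = ∫ t in (0:ℝ)..r, (radialIntegrand (1/(k₁:ℝ)) B₁m B₁p (fun _ => 1) t +
      radialIntegrand (1/(k₂:ℝ)) B₂m B₂p (fun _ => 1) t) := by
    rw [intervalIntegral.integral_add (hq₁.intervalIntegrable_of_Ici le_rfl hr)
      (hq₂.intervalIntegrable_of_Ici le_rfl hr), hP₁, hP₂]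
    simp only [radialIntegrand, mul_one]
  have hwa : ∀ t ∈ Set.Ici (0:ℝ), a₁ + a₂ ≤ v₁ (m + 1) t + v₂ (m + 1) t :=
    fun t ht => add_le_add (hw₁.le t ht) (hw₂.le t ht)
  have key : F (v₁ (m + 1) r + v₂ (m + 1) r) ≤ P₁ r + P₂ r := by
    rw [hF, hP]
    refine integral_inv_le_of_le_mul (U := fun r => v₁ (m + 1) r + v₂ (m + 1) r) hφ
      (fun t ht => hfpos t ht) (hh₁.add hh₂)
      (fun t ht => add_nonneg (hB₁.integrand_nonneg hs0₁ ht) (hB₂.integrand_nonneg hs0₂ ht))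
      (hq₁.add hq₂) (fun t ht => ?_) (fun t ht => ?_) hr
    · simp only [Pi.add_apply]
      rw [intervalIntegral.integral_add (hh₁.intervalIntegrable_of_Ici le_rfl ht)
        (hh₂.intervalIntegrable_of_Ici le_rfl ht), hv₁s, hv₂s]
      exact add_add_add_comm _ _ _ _
    · have hd := ha.le.trans (hwa t ht)
      have hp₁ := Real.rpow_nonneg (hf₁0 _ hd _ hd) (1/(k₁:ℝ))
      have hp₂ := Real.rpow_nonneg (hf₂0 _ hd _ hd) (1/(k₂:ℝ))
      have hi₁ := hB₁.integrand_nonneg (α := 1/(k₁:ℝ)) (g := fun _ => 1)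
        (fun _ _ => zero_le_one) ht
      have hi₂ := hB₂.integrand_nonneg (α := 1/(k₂:ℝ)) (g := fun _ => 1)
        (fun _ _ => zero_le_one) ht
      have he₁ := hB₁.integrand_source_le hα₁.le hf₁c hf₁0 hf₁mono ha₁ ha₂ hu₁ hu₂ hle₁ hle₂ ht
      have he₂ := hB₂.integrand_source_le hα₂.le hf₂c hf₂0 hf₂mono ha₁ ha₂ hu₁ hu₂ hle₁ hle₂ ht
      calc _ ≤ _ := add_le_add he₁ he₂
        _ ≤ _ := by
          rw [add_mul]
          exact add_le_add (mul_le_mul_of_nonneg_left (le_add_of_nonneg_right hi₂) hp₁)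
            (mul_le_mul_of_nonneg_left (le_add_of_nonneg_left hi₁) hp₂)
  refine ⟨key, fun ⟨s, hs, hPs⟩ => ?_⟩
  rw [hF] at key hPs
  exact le_of_integral_le_of_lt (continuousOn_const.div hφ fun t ht => (hfpos t ht).ne')
    (fun t ht => one_div_pos.2 (hfpos t ht)) (fun x hx => hF x ▸ hFinv x hx)
    (hwa r hr) key hs hPs
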